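/- arXiv:1712.01502 — 2 statements merged into one kernel-verified Lean document; each statement's English description precedes it below -/
import Mathlib

section
/- In the standing setting, for every nonempty finite subset S of X∖{∞}, the local polynomial entropy at S is at most the number of elements of S: h^loc_pol(f; S) ≤ #S. -/
open Filter Topology Set
open scoped ENNReal

/-- `E` is `(n, ε)`-separated for `f`: any two distinct points of `E` are `ε`-apart at some
time `k ∈ {0, …, n-1}`. -/
def IsDynSeparated {X : Type*} [MetricSpace X] (f : X → X) (n : ℕ) (ε : ℝ) (E : Set X) : Prop :=
  ∀ x ∈ E, ∀ y ∈ E, x ≠ y → ∃ k < n, ε < dist (f^[k] x) (f^[k] y)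

/-- `S(n, ε)`: the maximal cardinality of an `(n, ε)`-separated set. -/
noncomputable def maxSep {X : Type*} [MetricSpace X] (f : X → X) (n : ℕ) (ε : ℝ) : ℕ :=
  sSup {m | ∃ E : Finset X, IsDynSeparated f n ε ↑E ∧ E.card = m}

/-- Polynomial entropy `h_pol(f) = lim_{ε → 0} limsup_n (log S(n,ε) / log n)`, a value in
`[0, ∞]`.  Since `ε ↦ limsup_n (log S(n,ε) / log n)` is nonincreasing in `ε`, the limit as
`ε → 0⁺` is the supremum over `ε > 0`. -/
noncomputable def polEntropy {X : Type*} [MetricSpace X] (f : X → X) : ℝ≥0∞ :=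
  ⨆ (ε : ℝ) (_ : 0 < ε),
    Filter.atTop.limsup fun n : ℕ =>
      ENNReal.ofReal (Real.log (maxSep f n ε) / Real.log n)

/-- Topological entropy `h_top(f) = lim_{ε → 0} limsup_n (1/n) log S(n,ε)`. -/
noncomputable def topEntropy {X : Type*} [MetricSpace X] (f : X → X) : ℝ≥0∞ :=
  ⨆ (ε : ℝ) (_ : 0 < ε),
    Filter.atTop.limsup fun n : ℕ =>
      ENNReal.ofReal (Real.log (maxSep f n ε) / n)

/-- The set `A_n(ℱ)` of codings of orbit segments of length `n` relative to the finite
family `ℱ`: words `w` with letters in `ℱ ∪ {∞_ℱ}` (where `∞_ℱ` is the complement of `∪ℱ`)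
for which some orbit segment `(x, f x, …, f^{n-1} x)` satisfies `f^k x ∈ w k` for all `k`. -/
def codings {X : Type*} (f : X → X) (F : Finset (Set X)) (n : ℕ) : Set (Fin n → Set X) :=
  {w | (∀ k, w k ∈ F ∨ w k = (⋃₀ (F : Set (Set X)))ᶜ) ∧
      ∃ x : X, ∀ k : Fin n, f^[(k : ℕ)] x ∈ w k}

/-- Coding polynomial entropy of a finite family: `h_pol(f; ℱ) = limsup_n log #A_n(ℱ) / log n`.
For a single set `Y`, `h_pol(f; Y)` is `codingEntropy f {Y}`. -/
noncomputable def codingEntropy {X : Type*} (f : X → X) (F : Finset (Set X)) : ℝ≥0∞ :=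
  Filter.atTop.limsup fun n : ℕ =>
    ENNReal.ofReal (Real.log ((codings f F n).ncard) / Real.log n)

/-- The `n`-th iterate of a homeomorphism, for `n : ℤ`. -/
def zIter {X : Type*} [TopologicalSpace X] (f : X ≃ₜ X) (n : ℤ) (x : X) : X :=
  (f.toEquiv ^ n) x

/-- A set `Z` is wandering if `f^n(Z) ∩ Z = ∅` for every integer `n ≠ 0`. -/
def IsWanderingSet {X : Type*} [TopologicalSpace X] (f : X ≃ₜ X) (Z : Set X) : Prop :=
  ∀ n : ℤ, n ≠ 0 → zIter f n '' Z ∩ Z = ∅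

/-- Standing setting: `p` (the point written `∞` in the paper) is a fixed point of `f`, and
every other point is wandering, i.e. has a wandering neighborhood. -/
def StandingSetting {X : Type*} [TopologicalSpace X] (f : X ≃ₜ X) (p : X) : Prop :=
  f p = p ∧ ∀ x : X, x ≠ p → ∃ U ∈ 𝓝 x, IsWanderingSet f U

/-- `M(Y) = sup_{x ∈ X} #{n ∈ ℤ : f^n(x) ∈ Y}`. -/
noncomputable def orbitCount {X : Type*} [TopologicalSpace X] (f : X ≃ₜ X) (Y : Set X) : ℕ∞ :=
  ⨆ x : X, {n : ℤ | zIter f n x ∈ Y}.encard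

/-- Local polynomial entropy `h^loc_pol(f; S)` of a finite set `S`: the limit, along
decreasing neighborhood bases of the points of `S`, of the coding entropies of the
corresponding families of neighborhoods.  By monotonicity of the coding entropy this limit
equals the infimum of `h_pol(f; {U x : x ∈ S})` over all families `U` of respective
neighborhoods of the points of `S` such that `M(⋃_{x ∈ S} U x) < ∞` (such families exist,
and any decreasing neighborhood basis eventually consists of such sets). -/
noncomputable def localEntropy {X : Type*} [TopologicalSpace X] (f : X ≃ₜ X)
    (S : Finset X) : ℝ≥0∞ :=
  letI := Classical.decEq (Set X)
  ⨅ (U : X → Set X) (_ : ∀ x ∈ S, U x ∈ 𝓝 x)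
    (_ : orbitCount f (⋃ x ∈ S, U x) < ⊤),
    codingEntropy ⇑f (S.image U)

/-- The family `U` of sets (indexed by the points of `S`) is mutually singular: for every
`M` there are a point `x` and times `(N a)_{a ∈ S}` with `f^{N a}(x) ∈ U a` for all `a ∈ S`
and `|N a - N b| > M` for all `a ≠ b` in `S`. -/
def MutuallySingularFam {X : Type*} [TopologicalSpace X] (f : X ≃ₜ X) (S : Finset X)
    (U : X → Set X) : Prop :=
  ∀ M : ℕ, ∃ (x : X) (N : X → ℤ),
    (∀ a ∈ S, zIter f (N a) x ∈ U a) ∧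
    ∀ a ∈ S, ∀ b ∈ S, a ≠ b → (M : ℤ) < |N a - N b|

/-- A finite set `S` is singular if every family of respective neighborhoods of its points
is mutually singular. -/
def IsSingularSet {X : Type*} [TopologicalSpace X] (f : X ≃ₜ X) (S : Finset X) : Prop :=
  ∀ U : X → Set X, (∀ a ∈ S, U a ∈ 𝓝 a) → MutuallySingularFam f S U

theorem IsWanderingSet.eq_of_zIter_mem {X : Type*} [TopologicalSpace X] {f : X ≃ₜ X}
    {Z : Set X} (hZ : IsWanderingSet f Z) {x : X} {m n : ℤ}
    (hm : zIter f m x ∈ Z) (hn : zIter f n x ∈ Z) : m = n := by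
  by_contra hne
  have h := hZ (n - m) (sub_ne_zero.2 (Ne.symm hne))
  have hmem : zIter f n x ∈ zIter f (n - m) '' Z ∩ Z := by
    refine ⟨⟨zIter f m x, hm, ?_⟩, hn⟩
    unfold zIter
    rw [← Equiv.Perm.mul_apply, ← zpow_add, sub_add_cancel]
  rw [h] at hmem
  exact hmem

theorem zIter_natCast {X : Type*} [TopologicalSpace X] (f : X ≃ₜ X) (n : ℕ) (x : X) :
    zIter f n x = f^[n] x := by
  unfold zIter
  rw [zpow_natCast, Equiv.Perm.coe_pow]
  rfl

theorem IsWanderingSet.eq_of_iterate_mem {X : Type*} [TopologicalSpace X] {f : X ≃ₜ X}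
    {Z : Set X} (hZ : IsWanderingSet f Z) {x : X} {m n : ℕ}
    (hm : f^[m] x ∈ Z) (hn : f^[n] x ∈ Z) : m = n := by
  rw [← zIter_natCast] at hm hn
  exact_mod_cast hZ.eq_of_zIter_mem hm hn

theorem orbitCount_biUnion_le_card {X : Type*} [TopologicalSpace X] {f : X ≃ₜ X}
    {S : Finset X} {U : X → Set X} (hU : ∀ a ∈ S, IsWanderingSet f (U a)) :
    orbitCount f (⋃ a ∈ S, U a) ≤ S.card := by
  classical
  refine iSup_le fun x => ?_
  induction S using Finset.induction_on with
  | empty => simp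
  | insert a S ha ih =>
    have hsplit : {n : ℤ | zIter f n x ∈ ⋃ b ∈ insert a S, U b} =
        {n : ℤ | zIter f n x ∈ U a} ∪ {n : ℤ | zIter f n x ∈ ⋃ b ∈ S, U b} := by
      ext n
      simp
    have hone : {n : ℤ | zIter f n x ∈ U a}.encard ≤ 1 :=
      Set.encard_le_one_iff.2 fun m n hm hn =>
        (hU a (Finset.mem_insert_self a S)).eq_of_zIter_mem hm hn
    rw [hsplit, Finset.card_insert_of_notMem ha, Nat.cast_add, Nat.cast_one, add_comm]
    exact (Set.encard_union_le _ _).trans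
      (add_le_add hone (ih fun b hb => hU b (Finset.mem_insert_of_mem hb)))

theorem ncard_codings_le {X : Type*} [TopologicalSpace X] {f : X ≃ₜ X}
    {F : Finset (Set X)} (hF : ∀ Y ∈ F, IsWanderingSet f Y) (n : ℕ) :
    (codings f F n).ncard ≤ (n + 1) ^ F.card := by
  classical
  let φ : (Fin n → Set X) → F → Option (Fin n) := fun w Y =>
    if h : ∃ k, w k = Y then some h.choose else none
  have hφ : ∀ w ∈ codings f F n, ∀ (Y : F) (k : Fin n), φ w Y = some k ↔ w k = Y := by
    rintro w ⟨-, x, hx⟩ Y k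
    have huniq : ∀ i j, w i = Y → w j = Y → i = j := fun i j hi hj =>
      Fin.ext ((hF Y Y.2).eq_of_iterate_mem (hi ▸ hx i) (hj ▸ hx j))
    by_cases h : ∃ k, w k = Y
    · simp only [φ, dif_pos h, Option.some.injEq]
      exact ⟨fun e => e ▸ h.choose_spec, fun e => huniq _ _ h.choose_spec e⟩
    · simp only [φ, dif_neg h]
      exact ⟨fun e => by simp at e, fun e => (h ⟨k, e⟩).elim⟩
  have hinj : Set.InjOn φ (codings f F n) := by
    intro w hw w' hw' heq
    funext k
    rcases hw.1 k with h | h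
    · exact ((hφ w' hw' ⟨w k, h⟩ k).1 (heq ▸ (hφ w hw ⟨w k, h⟩ k).2 rfl)).symm
    · rcases hw'.1 k with h' | h'
      · exact (hφ w hw ⟨w' k, h'⟩ k).1 (heq ▸ (hφ w' hw' ⟨w' k, h'⟩ k).2 rfl)
      · rw [h, h']
  calc (codings f F n).ncard = (φ '' codings f F n).ncard := hinj.ncard_image.symm
    _ ≤ Nat.card (F → Option (Fin n)) := Set.ncard_le_card _
    _ = (n + 1) ^ F.card := by simp

theorem limsup_log_div_log_le {u : ℕ → ℕ} {s : ℕ} (hu : ∀ n, u n ≤ (n + 1) ^ s) :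
    atTop.limsup (fun n : ℕ => ENNReal.ofReal (Real.log (u n) / Real.log n)) ≤ (s : ℝ≥0∞) := by
  have hlog : Tendsto (fun n : ℕ => Real.log n) atTop atTop :=
    Real.tendsto_log_atTop.comp tendsto_natCast_atTop_atTop
  have hlim : Tendsto (fun n : ℕ => ENNReal.ofReal (s * (1 + Real.log 2 / Real.log n)))
      atTop (𝓝 (s : ℝ≥0∞)) := by
    have h := ((hlog.const_div_atTop (Real.log 2)).const_add 1).const_mul (s : ℝ)
    simpa using ENNReal.tendsto_ofReal h
  rw [← hlim.limsup_eq]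
  refine limsup_le_limsup ?_
  filter_upwards [eventually_ge_atTop 2] with n hn
  refine ENNReal.ofReal_le_ofReal ?_
  have hn' : (2 : ℝ) ≤ n := by exact_mod_cast hn
  have hpos : 0 < Real.log n := Real.log_pos (by linarith)
  have hsucc : Real.log (n + 1) ≤ Real.log n + Real.log 2 := by
    rw [← Real.log_mul (by linarith) two_ne_zero]
    exact Real.log_le_log (by linarith) (by linarith)
  have hbound : Real.log (u n) ≤ s * Real.log (n + 1) := by
    rw [← Real.log_pow]
    rcases Nat.eq_zero_or_pos (u n) with h0 | h0
    · rw [h0, Nat.cast_zero, Real.log_zero]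
      exact Real.log_nonneg (one_le_pow₀ (by linarith))
    · exact Real.log_le_log (by exact_mod_cast h0) (by exact_mod_cast hu n)
  have hrw : (s : ℝ) * (1 + Real.log 2 / Real.log n) * Real.log n =
      s * (Real.log n + Real.log 2) := by
    field_simp
  rw [div_le_iff₀ hpos, hrw]
  exact hbound.trans (mul_le_mul_of_nonneg_left hsucc s.cast_nonneg)

/-- the local polynomial entropy of a finite set is at most its
cardinality. -/
theorem localEntropy_le_card {X : Type*} [MetricSpace X] [CompactSpace X]
    (f : X ≃ₜ X) (p : X) (hst : StandingSetting f p)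
    (S : Finset X) (hSne : S.Nonempty) (hSp : ∀ a ∈ S, a ≠ p) :
    localEntropy f S ≤ (S.card : ℝ≥0∞) := by
  classical
  have hW : ∀ a : X, ∃ U : Set X, a ∈ S → U ∈ 𝓝 a ∧ IsWanderingSet f U := by
    intro a
    by_cases ha : a ∈ S
    · obtain ⟨U, hU, hUw⟩ := hst.2 a (hSp a ha)
      exact ⟨U, fun _ => ⟨hU, hUw⟩⟩
    · exact ⟨∅, fun h => (ha h).elim⟩
  choose U hU using hW
  unfold localEntropy
  refine iInf_le_of_le U (iInf_le_of_le (fun a ha => (hU a ha).1) (iInf_le_of_le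
    ((orbitCount_biUnion_le_card fun a ha => (hU a ha).2).trans_lt (ENat.natCast_lt_top _)) ?_))
  refine limsup_log_div_log_le fun n => (ncard_codings_le ?_ n).trans
    (Nat.pow_le_pow_right n.succ_pos Finset.card_image_le)
  intro Y hY
  obtain ⟨a, ha, rfl⟩ := Finset.mem_image.1 hY
  exact (hU a ha).2
end

section
/- In the standing setting, the topological entropy of f is zero. -/
open Filter Topology Set
open scoped ENNReal

/-- An orbit visits a wandering set at most once. -/
theorem IsWanderingSet.iterate_mem_unique {X : Type*} [TopologicalSpace X] {f : X ≃ₜ X}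
    {U : Set X} (hU : IsWanderingSet f U) {x : X} {k l : ℕ} (hk : f^[k] x ∈ U)
    (hl : f^[l] x ∈ U) : k = l := by
  wlog h : l < k generalizing k l
  · by_contra hne
    exact hne (this hl hk (by omega)).symm
  have hz : zIter f ((k - l : ℕ) : ℤ) (f^[l] x) = f^[k] x := by
    rw [zIter_natCast, ← Function.iterate_add_apply, Nat.sub_add_cancel h.le]
  have hmem : f^[k] x ∈ zIter f ((k - l : ℕ) : ℤ) '' U ∩ U := ⟨⟨_, hl, hz⟩, hk⟩
  rw [hU _ (by omega)] at hmem
  exact hmem.elim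

/-- Every point can be labelled by a nearby point of a finite set, in such a way that an orbit
carries each label other than `p` at most once. -/
theorem StandingSetting.exists_finite_labelling {X : Type*} [MetricSpace X] [CompactSpace X]
    {f : X ≃ₜ X} {p : X} (hst : StandingSetting f p) {r : ℝ} (hr : 0 < r) :
    ∃ (t : Finset X) (c : X → X), (∀ z, dist z (c z) < r) ∧ (∀ z, c z ≠ p → c z ∈ t) ∧
      ∀ x k l, c (f^[k] x) ≠ p → c (f^[k] x) = c (f^[l] x) → k = l := by
  have hV : ∀ x, ∃ V ∈ 𝓝 x, x ≠ p → IsWanderingSet f V := fun x ↦ by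
    by_cases h : x = p
    · exact ⟨univ, univ_mem, fun h' ↦ (h' h).elim⟩
    · obtain ⟨U, hU, hw⟩ := hst.2 x h
      exact ⟨U, hU, fun _ ↦ hw⟩
  choose V hVn hVw using hV
  obtain ⟨t, -, ht⟩ := (isCompact_univ (X := X)).elim_nhds_subcover
    (fun x ↦ V x ∩ Metric.ball x r)
    (fun x _ ↦ inter_mem (hVn x) (Metric.ball_mem_nhds x hr))
  have hc : ∀ z, ∃ x ∈ t, z ∈ V x ∧ dist z x < r := fun z ↦ by
    simpa [and_left_comm] using ht (mem_univ z)
  choose c hct hcV hcr using hc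
  refine ⟨t, c, hcr, fun z _ ↦ hct z, fun x k l hk hkl ↦ ?_⟩
  exact (hVw _ hk).iterate_mem_unique (hcV _) (hkl ▸ hcV (f^[l] x))

/-- In the standing setting, `S(n, ε)` grows at most polynomially in `n`. -/
theorem StandingSetting.exists_maxSep_le {X : Type*} [MetricSpace X] [CompactSpace X]
    {f : X ≃ₜ X} {p : X} (hst : StandingSetting f p) {ε : ℝ} (hε : 0 < ε) :
    ∃ L : ℕ, ∀ n, maxSep f n ε ≤ (n + 1) ^ L := by
  classical
  obtain ⟨t, c, hcr, hct, hcu⟩ := hst.exists_finite_labelling (half_pos hε)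
  refine ⟨t.card, fun n ↦ csSup_le' ?_⟩
  rintro _ ⟨E, hE, rfl⟩
  have hg : ∀ (x : X) (i : t), ∃ m : Fin (n + 1), (i : X) ≠ p →
      ∀ k < n, c (f^[k] x) = i ↔ k = m := fun x i ↦ by
    by_cases h : ∃ k < n, c (f^[k] x) = i
    · obtain ⟨k, hk, hki⟩ := h
      refine ⟨⟨k, by omega⟩, fun hi l _ ↦ ⟨fun hl ↦ ?_, fun hl ↦ ?_⟩⟩
      · exact hcu x l k (hl ▸ hi) (hl.trans hki.symm)
      · rw [hl]
        exact hki
    · refine ⟨Fin.last n, fun _ k hk ↦ ⟨fun hki ↦ (h ⟨k, hk, hki⟩).elim, fun hkn ↦ ?_⟩⟩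
      exact (hk.ne hkn).elim
  choose g hg using hg
  have hlabel : ∀ {x y : X} {k : ℕ}, g x = g y → k < n → c (f^[k] x) ≠ p →
      c (f^[k] y) = c (f^[k] x) := fun {x y k} hxy hk hne ↦ by
    let i : t := ⟨c (f^[k] x), hct _ hne⟩
    exact (hg y i hne k hk).2 (hxy ▸ (hg x i hne k hk).1 rfl)
  have hinj : Set.InjOn g E := fun x hx y hy hxy ↦ by
    by_contra hne
    obtain ⟨k, hk, hd⟩ := hE x hx y hy hne
    have hcc : c (f^[k] y) = c (f^[k] x) := by
      by_cases h : c (f^[k] x) = p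
      · by_cases h' : c (f^[k] y) = p
        · rw [h, h']
        · exact (hlabel hxy.symm hk h').symm
      · exact hlabel hxy hk h
    have h₁ := hcr (f^[k] x)
    have h₂ := hcr (f^[k] y)
    rw [hcc] at h₂
    linarith [dist_triangle_right (f^[k] x) (f^[k] y) (c (f^[k] x))]
  calc E.card ≤ (Finset.univ : Finset (t → Fin (n + 1))).card :=
        Finset.card_le_card_of_injOn g (fun _ _ ↦ Finset.mem_coe.2 (Finset.mem_univ _)) hinj
    _ = (n + 1) ^ t.card := by simp

theorem tendsto_mul_log_add_one_div_atTop (L : ℝ) :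
    Tendsto (fun n : ℕ ↦ L * Real.log (n + 1) / n) atTop (𝓝 0) := by
  have h := (Real.tendsto_pow_log_div_mul_add_atTop 1 (-1) 1 one_ne_zero).comp
    (tendsto_atTop_add_const_right atTop (1 : ℝ) tendsto_natCast_atTop_atTop)
  simpa [Function.comp_def, mul_div_assoc] using h.const_mul L

/-- in the standing setting, the topological entropy of `f` is zero. -/
theorem topEntropy_eq_zero {X : Type*} [MetricSpace X] [CompactSpace X]
    (f : X ≃ₜ X) (p : X) (hst : StandingSetting f p) :
    topEntropy ⇑f = 0 := by
  refine le_antisymm (iSup₂_le fun ε hε ↦ ?_) bot_le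
  obtain ⟨L, hL⟩ := hst.exists_maxSep_le hε
  have hlim := ENNReal.tendsto_ofReal (tendsto_mul_log_add_one_div_atTop L)
  rw [ENNReal.ofReal_zero] at hlim
  refine (limsup_le_limsup (Eventually.of_forall fun n ↦ ?_)).trans hlim.limsup_eq.le
  refine ENNReal.ofReal_le_ofReal (div_le_div_of_nonneg_right ?_ n.cast_nonneg)
  rcases Nat.eq_zero_or_pos (maxSep f n ε) with h | h
  · rw [h, Nat.cast_zero, Real.log_zero]
    exact mul_nonneg L.cast_nonneg (Real.log_nonneg (by simp))
  · rw [← Real.log_pow]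
    exact Real.log_le_log (by exact_mod_cast h) (by exact_mod_cast hL n)
end
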